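/- arXiv:1907.13577 — 3 statements merged into one kernel-verified Lean document; each statement's English description precedes it below -/
import Mathlib

section
/- Every regular language R over a finite alphabet A has only finitely many distinct derivatives; that is, the set {D_s R : s a string over A} is finite. -/
open Computability

/-- The derivative of a language `L` with respect to a string `s`: `{t | s ++ t ∈ L}`. -/
def Language.deriv {A : Type*} (L : Language A) (s : List A) : Language A :=
  {t | s ++ t ∈ L}

/-- A language is regular if it is the language denoted by some regular expression. -/
def Language.IsRegularExpressible {A : Type*} (L : Language A) : Prop :=
  ∃ r : RegularExpression A, r.matches' = L

namespace Language

variable {A : Type*}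

theorem mem_deriv {L : Language A} {s t : List A} : t ∈ L.deriv s ↔ s ++ t ∈ L := Iff.rfl

theorem mem_sSup {T : Set (Language A)} {t : List A} : t ∈ sSup T ↔ ∃ M ∈ T, t ∈ M :=
  Set.mem_sUnion

theorem deriv_add (L M : Language A) (s : List A) :
    (L + M).deriv s = L.deriv s + M.deriv s := rfl

theorem deriv_mul (L M : Language A) (s : List A) :
    (L * M).deriv s =
      L.deriv s * M + sSup {N | ∃ u v, s = u ++ v ∧ u ∈ L ∧ N = M.deriv v} := by
  ext t
  simp only [mem_deriv, mem_add, mem_mul, mem_sSup, Set.mem_ofPred_eq]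
  constructor
  · rintro ⟨a, ha, b, hb, hab⟩
    rcases List.append_eq_append_iff.1 hab with ⟨c, rfl, rfl⟩ | ⟨c, rfl, rfl⟩
    · exact Or.inr ⟨_, ⟨a, c, rfl, ha, rfl⟩, hb⟩
    · exact Or.inl ⟨c, ha, b, hb, rfl⟩
  · rintro (⟨a, ha, b, hb, rfl⟩ | ⟨_, ⟨u, v, rfl, hu, rfl⟩, ht⟩)
    · exact ⟨s ++ a, ha, b, hb, List.append_assoc ..⟩
    · exact ⟨u, hu, v ++ t, ht, (List.append_assoc ..).symm⟩

theorem append_mem_kstar {L : Language A} {u v : List A} (hu : u ∈ L∗) (hv : v ∈ L∗) :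
    u ++ v ∈ L∗ := by
  rw [← kstar_mul_kstar L]
  exact append_mem_mul hu hv

theorem deriv_kstar (L : Language A) (s : List A) :
    (L∗).deriv s =
      sSup {N | ∃ u v, s = u ++ v ∧ u ∈ L∗ ∧ N = L.deriv v} * L∗ +
        sSup {N | s ∈ L∗ ∧ N = L∗} := by
  ext t
  simp only [mem_deriv, mem_add, mem_mul, mem_sSup, Set.mem_ofPred_eq]
  constructor
  · intro h
    obtain ⟨S, hS, hL⟩ := mem_kstar.1 h
    rcases List.flatten_eq_append_iff.1 hS.symm with
      ⟨as, bs, rfl, rfl, rfl⟩ | ⟨as, bs, c, cs, ds, rfl, rfl, rfl⟩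
    · exact Or.inr ⟨_, ⟨join_mem_kstar fun y hy => hL y (by simp [hy]), rfl⟩,
        join_mem_kstar fun y hy => hL y (by simp [hy])⟩
    · exact Or.inl ⟨c :: cs, ⟨_, ⟨as.flatten, bs, rfl,
        join_mem_kstar fun y hy => hL y (by simp [hy]), rfl⟩, hL _ (by simp)⟩,
        ds.flatten, join_mem_kstar fun y hy => hL y (by simp [hy]), rfl⟩
  · rintro (⟨a, ⟨_, ⟨u, v, rfl, hu, rfl⟩, ha⟩, b, hb, rfl⟩ | ⟨_, ⟨hs, rfl⟩, ht⟩)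
    · have hva : v ++ a ∈ L∗ := (le_kstar : L ≤ L∗) ha
      simpa using append_mem_kstar hu (append_mem_kstar hva hb)
    · exact append_mem_kstar hs ht

theorem finite_range_deriv_add {L M : Language A} (hL : (Set.range L.deriv).Finite)
    (hM : (Set.range M.deriv).Finite) : (Set.range (L + M).deriv).Finite := by
  refine (hL.image2 (· + ·) hM).subset ?_
  rintro _ ⟨s, rfl⟩
  exact ⟨_, ⟨s, rfl⟩, _, ⟨s, rfl⟩, (deriv_add L M s).symm⟩

theorem finite_range_deriv_mul {L M : Language A} (hL : (Set.range L.deriv).Finite)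
    (hM : (Set.range M.deriv).Finite) : (Set.range (L * M).deriv).Finite := by
  refine (hL.image2 (fun X T => X * M + sSup T) hM.powerset).subset ?_
  rintro _ ⟨s, rfl⟩
  refine ⟨_, ⟨s, rfl⟩, _, ?_, (deriv_mul L M s).symm⟩
  rintro _ ⟨_, v, _, _, rfl⟩
  exact ⟨v, rfl⟩

theorem finite_range_deriv_kstar {L : Language A} (hL : (Set.range L.deriv).Finite) :
    (Set.range (L∗).deriv).Finite := by
  refine (hL.powerset.image2 (fun T E => sSup T * L∗ + sSup E)
    (Set.finite_singleton L∗).powerset).subset ?_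
  rintro _ ⟨s, rfl⟩
  refine ⟨_, ?_, _, ?_, (deriv_kstar L s).symm⟩
  · rintro _ ⟨_, v, _, _, rfl⟩
    exact ⟨v, rfl⟩
  · rintro _ ⟨_, rfl⟩
    rfl

theorem finite_range_deriv_zero : (Set.range (0 : Language A).deriv).Finite :=
  (Set.finite_singleton 0).subset (by rintro _ ⟨s, rfl⟩; rfl)

theorem finite_range_deriv_singleton (w : List A) :
    (Set.range ({w} : Language A).deriv).Finite := by
  refine (((List.finite_toSet w.tails).image
    fun v => ({v} : Language A)).insert 0).subset ?_
  rintro _ ⟨s, rfl⟩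
  by_cases h : s <+: w
  · obtain ⟨v, rfl⟩ := h
    refine Or.inr ⟨v, by simp, ?_⟩
    ext t
    exact ⟨fun ht => congrArg (s ++ ·) ht, fun ht => List.append_cancel_left ht⟩
  · refine Or.inl ?_
    ext t
    exact ⟨fun ht => (h ⟨t, ht⟩).elim, fun ht => (notMem_zero t ht).elim⟩

end Language

theorem RegularExpression.finite_range_deriv_matches' {A : Type*} (r : RegularExpression A) :
    (Set.range r.matches'.deriv).Finite := by
  induction r with
  | zero => exact Language.finite_range_deriv_zero
  | epsilon => exact Language.finite_range_deriv_singleton []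
  | char a => exact Language.finite_range_deriv_singleton [a]
  | plus P Q hP hQ => exact Language.finite_range_deriv_add hP hQ
  | comp P Q hP hQ => exact Language.finite_range_deriv_mul hP hQ
  | star P hP => exact Language.finite_range_deriv_kstar hP

/-- a regular language over a finite alphabet has only finitely many distinct
derivatives. -/
theorem isRegular_finite_derivatives {A : Type*} [Fintype A] (R : Language A)
    (hR : R.IsRegularExpressible) :
    {M : Language A | ∃ s : List A, M = R.deriv s}.Finite := by
  obtain ⟨r, rfl⟩ := hR
  refine r.finite_range_deriv_matches'.subset ?_
  rintro _ ⟨s, rfl⟩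
  exact ⟨s, rfl⟩
end

section
/- If a language L over a finite alphabet A has only finitely many distinct derivatives (the set {D_s L : s a string over A} is finite), then L is regular. -/
open Computability

namespace Language.IsRegularExpressible

variable {A : Type*} {L M : Language A}

theorem zero : (0 : Language A).IsRegularExpressible := ⟨0, rfl⟩

theorem one : (1 : Language A).IsRegularExpressible := ⟨1, rfl⟩

theorem singleton_char (a : A) : ({[a]} : Language A).IsRegularExpressible :=
  ⟨RegularExpression.char a, rfl⟩

theorem add (hL : L.IsRegularExpressible) (hM : M.IsRegularExpressible) :
    (L + M).IsRegularExpressible := by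
  obtain ⟨r, rfl⟩ := hL
  obtain ⟨s, rfl⟩ := hM
  exact ⟨r + s, rfl⟩

theorem mul (hL : L.IsRegularExpressible) (hM : M.IsRegularExpressible) :
    (L * M).IsRegularExpressible := by
  obtain ⟨r, rfl⟩ := hL
  obtain ⟨s, rfl⟩ := hM
  exact ⟨r * s, rfl⟩

theorem kstar (hL : L.IsRegularExpressible) : (L∗).IsRegularExpressible := by
  obtain ⟨r, rfl⟩ := hL
  exact ⟨r.star, rfl⟩

theorem sum {ι : Type*} (s : Finset ι) (X : ι → Language A)
    (hX : ∀ i ∈ s, (X i).IsRegularExpressible) : (∑ i ∈ s, X i).IsRegularExpressible :=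
  Finset.sum_induction X _ (fun _ _ => add) zero hX

end Language.IsRegularExpressible

theorem Language.mem_finset_sum {A ι : Type*} (s : Finset ι) (X : ι → Language A) (x : List A) :
    x ∈ ∑ i ∈ s, X i ↔ ∃ i ∈ s, x ∈ X i := by
  classical
  induction s using Finset.induction_on with
  | empty => simp [Language.notMem_zero]
  | insert k s hk ih => rw [Finset.sum_insert hk, Language.mem_add, ih, Finset.exists_mem_insert]

theorem Language.nil_notMem_mul_of_left {A : Type*} {L M : Language A} (h : [] ∉ L) :
    [] ∉ L * M := by
  simp [Language.mem_mul, h]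

/-- Components of a solution of a finite right-linear system of language equations with
regular coefficients, none of which multiplies an unknown by the empty word, are regular. -/
theorem Language.isRegularExpressible_of_linear_system {A ι : Type*} (s : Finset ι)
    (X : ι → Language A) (C : ι → ι → Language A) (B : ι → Language A)
    (hC : ∀ i j, (C i j).IsRegularExpressible) (hnil : ∀ i j, [] ∉ C i j)
    (hB : ∀ i, (B i).IsRegularExpressible)
    (hX : ∀ i ∈ s, X i = ∑ j ∈ s, C i j * X j + B i) :
    ∀ i ∈ s, (X i).IsRegularExpressible := by
  classical
  induction s using Finset.induction_on generalizing C B with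
  | empty => simp
  | insert k s hk ih =>
    have hXk : X k = (C k k)∗ * (∑ j ∈ s, C k j * X j + B k) := by
      rw [← Language.self_eq_mul_add_iff (hnil k k), ← add_assoc,
        ← Finset.sum_insert (f := fun j => C k j * X j) hk]
      exact hX k (Finset.mem_insert_self k s)
    have hs : ∀ i ∈ s, (X i).IsRegularExpressible := by
      refine ih (fun i j => C i j + C i k * ((C k k)∗ * C k j))
        (fun i => B i + C i k * ((C k k)∗ * B k))
        (fun i j => (hC i j).add ((hC i k).mul ((hC k k).kstar.mul (hC k j))))
        (fun i j => ?_) (fun i => (hB i).add ((hC i k).mul ((hC k k).kstar.mul (hB k))))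
        (fun i hi => ?_)
      · rw [Language.mem_add, not_or]
        exact ⟨hnil i j, Language.nil_notMem_mul_of_left (hnil i k)⟩
      · calc X i = C i k * X k + ∑ j ∈ s, C i j * X j + B i := by
              rw [← Finset.sum_insert (f := fun j => C i j * X j) hk]
              exact hX i (Finset.mem_insert_of_mem hi)
          _ = _ := by
              rw [hXk]
              simp only [mul_add, add_mul, Finset.sum_add_distrib, Finset.mul_sum, mul_assoc]
              abel
    intro i hi
    obtain rfl | hi := Finset.mem_insert.mp hi
    · rw [hXk]
      exact (hC i i).kstar.mul ((IsRegularExpressible.sum s _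
        fun j hj => (hC i j).mul (hs j hj)).add (hB i))
    · exact hs i hi

/-- a language over a finite alphabet with only finitely many distinct derivatives
is regular. -/
theorem finite_derivatives_isRegular {A : Type*} [Fintype A] (L : Language A)
    (h : {M : Language A | ∃ s : List A, M = L.deriv s}.Finite) :
    L.IsRegularExpressible := by
  classical
  refine Language.isRegularExpressible_of_linear_system h.toFinset id
    (fun M N => ∑ a with M.deriv [a] = N, {[a]}) (fun M => if [] ∈ M then 1 else 0)
    (fun M N => .sum _ _ fun a _ => .singleton_char a) (fun M N => ?_) (fun M => ?_)
    (fun M hM => ?_) L (h.mem_toFinset.mpr ⟨[], rfl⟩)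
  · rw [Language.mem_finset_sum]
    rintro ⟨a, -, ha⟩
    exact List.cons_ne_nil a [] (Set.mem_singleton_iff.mp ha).symm
  · split_ifs
    exacts [.one, .zero]
  · obtain ⟨s, rfl⟩ := h.mem_toFinset.mp hM
    ext x
    simp only [id, Language.mem_add, Language.mem_finset_sum, Language.mem_mul,
      Set.Finite.mem_toFinset, Finset.mem_filter, Finset.mem_univ, true_and]
    constructor
    · intro hx
      cases x with
      | nil => exact Or.inr (by rw [if_pos hx]; exact Language.nil_mem_one)
      | cons a x =>
        refine Or.inl ⟨_, ⟨s ++ [a], ?_⟩, [a], ⟨a, rfl, rfl⟩, x, hx, rfl⟩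
        ext y
        change s ++ ([a] ++ y) ∈ L ↔ s ++ [a] ++ y ∈ L
        rw [List.append_assoc]
    · rintro (⟨_, -, _, ⟨a, rfl, rfl⟩, y, hy, rfl⟩ | hx)
      · exact hy
      · split_ifs at hx with hnil
        · rwa [(Language.mem_one x).mp hx]
        · exact absurd hx (Language.notMem_zero x)
end

section
/- Let L be a language over a finite alphabet A whose set of distinct derivatives {D_s L : s a string over A} is finite, of cardinality d. Then every derivative of L occurs as the derivative with respect to some string of length at most d − 1: for every string s over A there exists a string t over A with |t| ≤ d − 1 and D_s L = D_t L. -/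
open Computability

/-- Equal derivatives stay equal after appending the same string. -/
theorem Language.deriv_append_congr {A : Type*} {L : Language A} {u v : List A}
    (h : L.deriv u = L.deriv v) (w : List A) : L.deriv (u ++ w) = L.deriv (v ++ w) := by
  ext x
  have hx : w ++ x ∈ L.deriv u ↔ w ++ x ∈ L.deriv v := by rw [h]
  change u ++ (w ++ x) ∈ L ↔ v ++ (w ++ x) ∈ L at hx
  change (u ++ w) ++ x ∈ L ↔ (v ++ w) ++ x ∈ L
  simpa only [List.append_assoc] using hx

/-- If two prefixes of `t` of different lengths have the same derivative, then the derivative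
with respect to `t` is also attained at a strictly shorter string. -/
theorem Language.exists_shorter_deriv_eq {A : Type*} {L : Language A} {t : List A} {i j : ℕ}
    (hij : i < j) (hj : j ≤ t.length) (h : L.deriv (t.take i) = L.deriv (t.take j)) :
    ∃ u : List A, u.length < t.length ∧ L.deriv u = L.deriv t := by
  refine ⟨t.take i ++ t.drop j, ?_, ?_⟩
  · simp only [List.length_append, List.length_take, List.length_drop]
    omega
  · simpa only [List.take_append_drop] using Language.deriv_append_congr h (t.drop j)

/-- if the set of distinct derivatives of `L` is finite of cardinality `d`, then
every derivative already occurs with respect to a string of length at most `d - 1`. -/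
theorem characteristic_derivatives {A : Type*} [Fintype A] (L : Language A) (d : ℕ)
    (hfin : {M : Language A | ∃ s : List A, M = L.deriv s}.Finite)
    (hcard : {M : Language A | ∃ s : List A, M = L.deriv s}.ncard = d) :
    ∀ s : List A, ∃ t : List A, t.length ≤ d - 1 ∧ L.deriv s = L.deriv t := by
  classical
  intro s
  have hex : ∃ n : ℕ, ∃ t : List A, t.length = n ∧ L.deriv s = L.deriv t := ⟨_, s, rfl, rfl⟩
  obtain ⟨t, hlen, hst⟩ := Nat.find_spec hex
  have hmin (u : List A) (hu : L.deriv u = L.deriv t) : t.length ≤ u.length :=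
    hlen.trans_le (Nat.find_min' hex ⟨u, rfl, hst.trans hu.symm⟩)
  refine ⟨t, ?_, hst⟩
  have hne {i j : ℕ} (hij : i < j) (hj : j ≤ t.length) :
      L.deriv (t.take i) ≠ L.deriv (t.take j) := fun h =>
    let ⟨u, hlt, hu⟩ := Language.exists_shorter_deriv_eq hij hj h
    (hmin u hu).not_gt hlt
  have hle : (Finset.range (t.length + 1)).card ≤ hfin.toFinset.card := by
    refine Finset.card_le_card_of_injOn (fun i => L.deriv (t.take i)) ?_ ?_
    · intro i _
      simp only [Set.Finite.coe_toFinset]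
      exact ⟨_, rfl⟩
    · intro i hi j hj h
      simp only [Finset.coe_range, Set.mem_Iio] at hi hj
      rcases lt_trichotomy i j with hij | hij | hij
      · exact (hne hij (by omega) h).elim
      · exact hij
      · exact (hne hij (by omega) h.symm).elim
  rw [Finset.card_range, ← Set.ncard_eq_toFinset_card _ hfin, hcard] at hle
  omega
end
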